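/- arXiv:1106.2235 — 2 statements merged into one kernel-verified Lean document; each statement's English description precedes it below -/
import Mathlib

section
/- Let X be a Polish space and K ⊆ X a coanalytic set that is not analytic. Suppose (B_α)_{α<ω₁} is a family of Borel subsets of X with B_α ⊆ B_β ⊆ K for α ≤ β < ω₁, ∪_{α<ω₁} B_α = K, and such that every analytic subset A ⊆ K is contained in B_α for some α < ω₁. Then for any transfinite sequence of points x_α ∈ K ∖ B_α (α < ω₁), the set {x_α : α < ω₁} is universally small in X. -/
open Set MeasureTheory

/-- `I` is a ccc σ-ideal with Borel base on `X`. -/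
structure IsCccBorelSigmaIdeal (X : Type*) [MeasurableSpace X] (I : Set (Set X)) : Prop where
  sUnion_eq_univ : ⋃₀ I = Set.univ
  univ_not_mem : Set.univ ∉ I
  union_mem : ∀ A ∈ I, ∀ B ∈ I, A ∪ B ∈ I
  subset_mem : ∀ A ∈ I, ∀ B : Set X, B ⊆ A → B ∈ I
  iUnion_mem : ∀ f : ℕ → Set X, (∀ n, f n ∈ I) → (⋃ n, f n) ∈ I
  borel_base : ∀ A ∈ I, ∃ B : Set X, MeasurableSet B ∧ A ⊆ B ∧ B ∈ I
  ccc : ∀ F : Set (Set X), (∀ B ∈ F, MeasurableSet B ∧ B ∉ I) →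
    F.PairwiseDisjoint id → F.Countable

/-- A set is universally small if it belongs to every ccc σ-ideal with Borel base. -/
def UniversallySmall {X : Type*} [MeasurableSpace X] (A : Set X) : Prop :=
  ∀ I : Set (Set X), IsCccBorelSigmaIdeal X I → A ∈ I

/-- The first uncountable ordinal. -/
noncomputable def omega1 : Ordinal.{0} := (Cardinal.aleph 1).ord

namespace USmall

variable {X : Type*} [MeasurableSpace X] {I : Set (Set X)}

lemma empty_mem [Nonempty X] (h : IsCccBorelSigmaIdeal X I) : (∅ : Set X) ∈ I := by
  obtain ⟨p⟩ := ‹Nonempty X›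
  have hp : p ∈ ⋃₀ I := by rw [h.sUnion_eq_univ]; trivial
  obtain ⟨A, hA, _⟩ := hp
  exact h.subset_mem A hA _ (empty_subset _)

lemma singleton_mem (h : IsCccBorelSigmaIdeal X I) (p : X) : ({p} : Set X) ∈ I := by
  have hp : p ∈ ⋃₀ I := by rw [h.sUnion_eq_univ]; trivial
  obtain ⟨A, hA, hpA⟩ := hp
  exact h.subset_mem A hA _ (singleton_subset_iff.2 hpA)

lemma sUnion_mem [Nonempty X] (h : IsCccBorelSigmaIdeal X I) (S : Set (Set X))
    (hS : S.Countable) (hSI : ∀ A ∈ S, A ∈ I) : ⋃₀ S ∈ I := by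
  rcases S.eq_empty_or_nonempty with rfl | hne
  · simpa using empty_mem h
  · obtain ⟨f, rfl⟩ := hS.exists_eq_range hne
    rw [sUnion_range]
    exact h.iUnion_mem f (fun n => hSI _ (mem_range_self n))

lemma countable_mem [Nonempty X] (h : IsCccBorelSigmaIdeal X I) (S : Set X)
    (hS : S.Countable) : S ∈ I := by
  have := sUnion_mem h ((fun p => ({p} : Set X)) '' S) (hS.image _)
    (by rintro _ ⟨p, _, rfl⟩; exact singleton_mem h p)
  simpa using this

/-- Borel hull modulo the ideal. -/
lemma exists_hull [Nonempty X] (h : IsCccBorelSigmaIdeal X I) (E : Set X) :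
    ∃ H : Set X, MeasurableSet H ∧ E ⊆ H ∧
      ∀ Z : Set X, MeasurableSet Z → Z ⊆ H → Disjoint Z E → Z ∈ I := by
  let P : Set (Set (Set X)) := {F | (∀ B ∈ F, MeasurableSet B ∧ B ∉ I ∧ Disjoint B E) ∧
    F.PairwiseDisjoint id}
  obtain ⟨F, hF⟩ := zorn_subset P (by
    intro c hc hchain
    refine ⟨⋃₀ c, ⟨?_, ?_⟩, fun s hs => subset_sUnion_of_mem hs⟩
    · rintro B ⟨F, hFc, hBF⟩
      exact (hc hFc).1 B hBF
    · exact (pairwiseDisjoint_sUnion hchain.directedOn).2 (fun F hFc => (hc hFc).2))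
  obtain ⟨⟨hF1, hF2⟩, hmax⟩ := hF
  have hFc : F.Countable := h.ccc F (fun B hB => ⟨(hF1 B hB).1, (hF1 B hB).2.1⟩) hF2
  refine ⟨(⋃₀ F)ᶜ, (MeasurableSet.sUnion hFc (fun B hB => (hF1 B hB).1)).compl, ?_, ?_⟩
  · rintro p hp ⟨B, hB, hpB⟩
    exact Set.disjoint_left.1 (hF1 B hB).2.2 hpB hp
  · intro Z hZ hZH hZE
    by_contra hZI
    have hdis : ∀ B ∈ F, Disjoint Z B := fun B hB =>
      Set.disjoint_left.2 (fun p hpZ hpB => hZH hpZ ⟨B, hB, hpB⟩)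
    have hins : insert Z F ∈ P := by
      refine ⟨?_, ?_⟩
      · rintro B (rfl | hB)
        · exact ⟨hZ, hZI, hZE⟩
        · exact hF1 B hB
      · exact hF2.insert (fun B hB _ => hdis B hB)
    have hZF : Z ∈ F := hmax hins (subset_insert _ _) (mem_insert _ _)
    have : Z = ∅ := by simpa using hdis Z hZF
    subst this
    exact hZI (empty_mem h)


/-- Marczewski: analytic sets are measurable modulo a ccc sigma-ideal with Borel base. -/
lemma exists_borel_superset [Nonempty X] [TopologicalSpace X] [T2Space X] [BorelSpace X]
    (h : IsCccBorelSigmaIdeal X I) (A : Set X) (hA : AnalyticSet A) :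
    ∃ C : Set X, MeasurableSet C ∧ A ⊆ C ∧ C \ A ∈ I := by
  rw [AnalyticSet] at hA
  rcases hA with rfl | ⟨f, hf, rfl⟩
  · exact ⟨∅, MeasurableSet.empty, subset_rfl, by simpa using empty_mem h⟩
  let N : List ℕ → Set (ℕ → ℕ) := fun s => {y | PiNat.res y s.length = s}
  choose H0 hH0m hH0s hH0 using fun s : List ℕ => exists_hull h (f '' N s)
  let H : List ℕ → Set X := fun s => H0 s ∩ closure (f '' N s)
  have hHm : ∀ s, MeasurableSet (H s) := fun s =>
    (hH0m s).inter isClosed_closure.measurableSet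
  have hHs : ∀ s, f '' N s ⊆ H s := fun s => subset_inter (hH0s s) subset_closure
  let D : List ℕ → Set X := fun s => H s \ ⋃ n, H (n :: s)
  have hD : ∀ s, D s ∈ I := by
    intro s
    refine hH0 s _ ((hHm s).diff (MeasurableSet.iUnion fun n => hHm _))
      (diff_subset.trans inter_subset_left) ?_
    rw [Set.disjoint_left]
    rintro _ ⟨_, hp⟩ ⟨y, hy, rfl⟩
    apply hp
    refine mem_iUnion.2 ⟨y s.length, hHs _ ⟨y, ?_, rfl⟩⟩
    have hy' : PiNat.res y s.length = s := hy
    change PiNat.res y (s.length + 1) = y s.length :: s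
    rw [PiNat.res_succ, hy']
  have hDU : ⋃₀ (range D) ∈ I :=
    sUnion_mem h _ (countable_range D) (by rintro _ ⟨s, rfl⟩; exact hD s)
  refine ⟨H [], hHm _, ?_, h.subset_mem _ hDU _ ?_⟩
  · rintro _ ⟨y, rfl⟩
    exact hHs [] ⟨y, rfl, rfl⟩
  · rintro p ⟨hp, hpA⟩
    by_contra hpD
    have hstep : ∀ s, p ∈ H s → ∃ n, p ∈ H (n :: s) := by
      intro s hs
      by_contra hcon
      exact hpD ⟨D s, mem_range_self s, hs, fun hu => hcon (mem_iUnion.1 hu)⟩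
    have hstep' : ∀ s, ∃ n, p ∈ H s → p ∈ H (n :: s) := by
      intro s
      by_cases hs : p ∈ H s
      · obtain ⟨n, hn⟩ := hstep s hs
        exact ⟨n, fun _ => hn⟩
      · exact ⟨0, fun hh => absurd hh hs⟩
    choose g hg using hstep'
    let S : ℕ → List ℕ := fun k => Nat.rec [] (fun _ s => g s :: s) k
    have hS : ∀ k, p ∈ H (S k) := by
      intro k
      induction k with
      | zero => exact hp
      | succ k ih => exact hg _ ih
    let y : ℕ → ℕ := fun k => g (S k)
    have hSy : ∀ k, S k = PiNat.res y k := by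
      intro k
      induction k with
      | zero => rfl
      | succ k ih =>
        rw [PiNat.res_succ, ← ih]
    have hpy : p ≠ f y := fun hh => hpA ⟨y, hh.symm⟩
    obtain ⟨U, V, hU, hV, hpU, hyV, hUV⟩ := t2_separation hpy
    obtain ⟨k, hk⟩ := PiNat.exists_disjoint_cylinder (hV.preimage hf).isClosed_compl
      (x := y) (by simpa using hyV)
    have hcl : p ∈ closure (f '' N (S k)) := (hS k).2
    obtain ⟨_, hqU, ⟨z, hz, rfl⟩⟩ := mem_closure_iff.1 hcl U hU hpU
    have hz' : z ∈ PiNat.cylinder y k := by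
      rw [PiNat.cylinder_eq_res]
      have hz2 : PiNat.res z (S k).length = S k := hz
      rw [hSy, PiNat.res_length] at hz2
      exact hz2
    have hzV : f z ∈ V := by
      by_contra hzV
      exact Set.disjoint_left.1 hk hzV hz'
    exact Set.disjoint_left.1 hUV hqU hzV

end USmall

/-- If `K` is a coanalytic non-analytic subset of a Polish space `X`,
`(B α)_{α < ω₁}` is an increasing family of Borel subsets of `K` covering `K` such
that every analytic subset of `K` lies in some `B α` (the level sets of a coanalytic
rank function on `K`), then for any choice of points `x α ∈ K ∖ B α` (`α < ω₁`) the
set `{x α : α < ω₁}` is universally small in `X`. -/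
theorem universally_small_of_rank_unbounded
    {X : Type*} [TopologicalSpace X] [PolishSpace X] [MeasurableSpace X] [BorelSpace X]
    (K : Set X) (hKco : AnalyticSet Kᶜ) (hKna : ¬ AnalyticSet K)
    (B : Ordinal.{0} → Set X)
    (hBorel : ∀ α < omega1, MeasurableSet (B α))
    (hmono : ∀ α β : Ordinal.{0}, α ≤ β → β < omega1 → B α ⊆ B β)
    (hsub : ∀ α < omega1, B α ⊆ K)
    (hcover : ∀ y ∈ K, ∃ α < omega1, y ∈ B α)
    (hrank : ∀ A : Set X, A ⊆ K → AnalyticSet A → ∃ α < omega1, A ⊆ B α)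
    (x : Ordinal.{0} → X) (hx : ∀ α < omega1, x α ∈ K \ B α) :
    UniversallySmall {p : X | ∃ α < omega1, p = x α} := by
  intro I hI
  have : Nonempty X := ⟨x 0⟩
  obtain ⟨C, hC, hAC, hCI⟩ := USmall.exists_borel_superset hI Kᶜ hKco
  obtain ⟨α, hα, hLα⟩ := hrank Cᶜ (compl_subset_comm.1 hAC) hC.compl.analyticSet
  have hcount : (x '' Set.Iio α).Countable := by
    apply Set.Countable.image
    rw [← Cardinal.le_aleph0_iff_set_countable, Cardinal.mk_Iio_ordinal,
      Cardinal.lift_le_aleph0, ← Cardinal.lt_aleph_one_iff]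
    exact Cardinal.lt_ord.1 hα
  refine hI.subset_mem _ (hI.union_mem _ hCI _ (USmall.countable_mem hI _ hcount)) _ ?_
  rintro _ ⟨β, hβ, rfl⟩
  rcases lt_or_ge β α with hlt | hge
  · exact Or.inr ⟨β, hlt, rfl⟩
  · refine Or.inl ⟨?_, fun hn => hn (hx β hβ).1⟩
    by_contra hnC
    exact (hx β hβ).2 (hmono α β hge hβ (hLα hnC))
end

section
/- Let G be an Abelian group, U ⊆ G, and C ⊆ G a countable set with C + U = G. Suppose (x_α)_{α<ω₁} and (y_α)_{α<ω₁} are families of elements of G such that the points x_α are pairwise distinct and for every u ∈ U the set Ω_u = {α < ω₁ : x_α − y_α = u} is uncountable. Then the set A = {c + x_α : c ∈ C, α < ω₁} ∪ {y_α : α < ω₁} satisfies |A ∩ (z + A)| ≥ ℵ₁ for every z ∈ G. -/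
open Set Pointwise

/-- Let `G` be an Abelian group, `U ⊆ G`, and `C ⊆ G` a countable set with
`C + U = G`. If `(x α)`, `(y α)` (`α < ω₁`) are families in `G` with the `x α`
pairwise distinct and such that for every `u ∈ U` the set
`Ω_u = {α < ω₁ : x α − y α = u}` is uncountable, then
`A = {c + x α : c ∈ C, α < ω₁} ∪ {y α : α < ω₁}` satisfies
`|A ∩ (z + A)| ≥ ℵ₁` for every `z ∈ G`. -/
theorem aleph_one_le_card_inter_translate
    {G : Type u} [AddCommGroup G]
    (U C : Set G) (hCc : C.Countable) (hCU : C + U = Set.univ)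
    (x y : Ordinal.{0} → G)
    (hxinj : ∀ α < omega1, ∀ β < omega1, α ≠ β → x α ≠ x β)
    (hΩ : ∀ u ∈ U, ¬ Set.Countable {α : Ordinal.{0} | α < omega1 ∧ x α - y α = u}) :
    ∀ z : G,
      Cardinal.aleph 1 ≤ Cardinal.mk
        ↥(({g : G | (∃ c ∈ C, ∃ α < omega1, g = c + x α) ∨ ∃ α < omega1, g = y α} : Set G) ∩
          (z +ᵥ ({g : G | (∃ c ∈ C, ∃ α < omega1, g = c + x α) ∨ ∃ α < omega1, g = y α} : Set G))) := by
  intro z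
  have hz : z ∈ C + U := hCU ▸ Set.mem_univ z
  obtain ⟨c, hc, u, hu, rfl⟩ := Set.mem_add.1 hz
  by_contra hlt
  rw [not_le, ← Cardinal.succ_aleph0, Order.lt_succ_iff, Cardinal.le_aleph0_iff_set_countable] at hlt
  refine hΩ u hu ?_
  refine Set.MapsTo.countable_of_injOn (f := fun α => c + x α) ?_ ?_ hlt
  · rintro α ⟨hα, h⟩
    refine ⟨Or.inl ⟨c, hc, α, hα, rfl⟩, ?_⟩
    refine Set.mem_vadd_set.2 ⟨y α, Or.inr ⟨α, hα, rfl⟩, ?_⟩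
    simp only [vadd_eq_add]
    rw [← h]
    abel
  · rintro α ⟨hα, -⟩ β ⟨hβ, -⟩ h
    by_contra hne
    exact hxinj α hα β hβ hne (add_left_cancel h)
end
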